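/- Let G and H be finite simple graphs such that G is a topological minor of H. If G ∈ 𝒰, then H ∈ 𝒰. -/

import Mathlib

open SimpleGraph

namespace Sat2

abbrev Lit (V : Type) := V × Bool
abbrev TwoCNF (V : Type) := List (Lit V × Lit V)

/-- An assignment satisfies a 2-CNF if it satisfies at least one literal
of every clause. -/
def SatTwoCNF {V : Type} (τ : V → Bool) (S : TwoCNF V) : Prop :=
  ∀ c ∈ S, τ c.1.1 = c.1.2 ∨ τ c.2.1 = c.2.2

def TwoSatisfiable {V : Type} (S : TwoCNF V) : Prop := ∃ τ, SatTwoCNF τ S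

/-- The unordered pair of underlying variables of a 2-clause. -/
def clauseVars {V : Type} (c : Lit V × Lit V) : Sym2 V := s(c.1.1, c.2.1)

/-- A 2-CNF is simple if in every clause the two literals have distinct
underlying variables, and no two distinct clauses have the same unordered
pair of underlying variables. -/
def SimpleTwoCNF {V : Type} (S : TwoCNF V) : Prop :=
  (∀ c ∈ S, c.1.1 ≠ c.2.1) ∧ (S.map clauseVars).Nodup

/-- A 2-CNF `S` is supported on a simple graph `G` (with vertex type equal to
the variable type) when clause ↦ unordered pair of variables is a bijection
from the clauses of `S` onto the edges of `G`. -/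
def SupportedOn {V : Type} (S : TwoCNF V) (G : SimpleGraph V) : Prop :=
  (S.map clauseVars).Nodup ∧ {e : Sym2 V | e ∈ S.map clauseVars} = G.edgeSet

/-- `G ∈ 𝒰`: some unsatisfiable simple 2-CNF is supported on `G`. -/
def InU {V : Type} (G : SimpleGraph V) : Prop :=
  ∃ S : TwoCNF V, SimpleTwoCNF S ∧ SupportedOn S G ∧ ¬ TwoSatisfiable S

/-- `G` is isomorphic to a subgraph of `H`. -/
def IsSubgraphOf {α β : Type} (G : SimpleGraph α) (H : SimpleGraph β) : Prop :=
  ∃ f : α → β, Function.Injective f ∧ ∀ ⦃u v⦄, G.Adj u v → H.Adj (f u) (f v)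

/-- The graph obtained from `G` by subdividing the edge `(u, v)`:
the edge `(u,v)` is replaced by a path `u – w – v` through the
new vertex `w = none`. -/
def subdivideEdge {α : Type} (G : SimpleGraph α) (u v : α) :
    SimpleGraph (Option α) :=
  SimpleGraph.fromRel (fun a b =>
    match a, b with
    | some x, some y => G.Adj x y ∧ s(x, y) ≠ s(u, v)
    | some x, none => x = u ∨ x = v
    | _, _ => False)

/-- `IsSubdivision G H` : `H` is (up to starting isomorphism) obtained from `G`
by repeatedly subdividing edges. -/
inductive IsSubdivision : {α β : Type} → SimpleGraph α → SimpleGraph β → Prop where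
  | of_iso {α β : Type} {G : SimpleGraph α} {H : SimpleGraph β} :
      (G ≃g H) → IsSubdivision G H
  | step {α β : Type} {G : SimpleGraph α} {H : SimpleGraph β} (u v : β) :
      IsSubdivision G H → H.Adj u v → IsSubdivision G (subdivideEdge H u v)

/-- `G` is a topological minor of `H`: some subdivision of `G` is isomorphic
to a subgraph of `H`. -/
def IsTopMinor {α β : Type} (G : SimpleGraph α) (H : SimpleGraph β) : Prop :=
  ∃ (γ : Type) (G' : SimpleGraph γ), IsSubdivision G G' ∧ IsSubgraphOf G' H

/-- Contraction of the edge `(u,v)`: delete `v` and merge it into `u`. -/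
def contractEdge {α : Type} (G : SimpleGraph α) (u v : α) :
    SimpleGraph {w : α // w ≠ v} :=
  SimpleGraph.fromRel (fun a b =>
    G.Adj a.val b.val ∨ (a.val = u ∧ G.Adj v b.val) ∨ (b.val = u ∧ G.Adj a.val v))

/-- `ContractionSeq H G` : `G` can be obtained from `H` by a sequence of edge
contractions, each performed at an edge whose endpoints have no common
neighbor at the time of contraction. -/
inductive ContractionSeq : {α β : Type} → SimpleGraph α → SimpleGraph β → Prop where
  | of_iso {α β : Type} {H : SimpleGraph α} {G : SimpleGraph β} :
      (H ≃g G) → ContractionSeq H G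
  | step {α β : Type} {H : SimpleGraph α} {G : SimpleGraph β} (u v : α) :
      H.Adj u v → (∀ w, ¬(H.Adj u w ∧ H.Adj v w)) →
      ContractionSeq (contractEdge H u v) G → ContractionSeq H G

/-- The butterfly graph: two triangles sharing exactly one vertex. -/
def butterfly : SimpleGraph (Fin 5) :=
  SimpleGraph.fromEdgeSet {s(0,1), s(0,2), s(1,2), s(2,3), s(2,4), s(3,4)}

/-- The bowtie graph: two vertex-disjoint triangles joined by a single edge. -/
def bowtie : SimpleGraph (Fin 6) :=
  SimpleGraph.fromEdgeSet {s(0,1), s(0,2), s(1,2), s(2,3), s(3,4), s(3,5), s(4,5)}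

/-- The complete graph on four vertices. -/
def K4 : SimpleGraph (Fin 4) := ⊤

/-- The complete tripartite graph `K_{1,1,3}`, with parts {0}, {1}, {2,3,4}. -/
def K113 : SimpleGraph (Fin 5) :=
  SimpleGraph.fromEdgeSet {s(0,1), s(0,2), s(0,3), s(0,4), s(1,2), s(1,3), s(1,4)}

/-- The complete graph on four vertices with one edge deleted. -/
def K4minusE : SimpleGraph (Fin 4) :=
  SimpleGraph.fromEdgeSet {s(0,1), s(0,2), s(0,3), s(1,2), s(1,3)}

/-- Some choice of signs `g u v` (the sign of `u` in the clause of the edge `uv`) makes the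
clauses of the edges of `G` jointly unsatisfiable. -/
def HasUnsatSigning {V : Type} (G : SimpleGraph V) : Prop :=
  ∃ g : V → V → Bool, ∀ τ : V → Bool, ∃ u v, G.Adj u v ∧ τ u ≠ g u v ∧ τ v ≠ g v u

theorem InU.hasUnsatSigning {V : Type} {G : SimpleGraph V} (h : InU G) :
    HasUnsatSigning G := by
  classical
  obtain ⟨S, ⟨hne, -⟩, ⟨hnd, hS⟩, hunsat⟩ := h
  have huniq := List.inj_on_of_nodup_map hnd
  refine ⟨fun u v => decide (∃ c ∈ S, (c.1 = (u, true) ∧ c.2.1 = v) ∨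
    (c.2 = (u, true) ∧ c.1.1 = v)), fun τ => ?_⟩
  by_contra! hτ
  refine hunsat ⟨τ, fun c hc => ?_⟩
  have hadj : G.Adj c.1.1 c.2.1 := by
    rw [← mem_edgeSet, ← hS]
    exact List.mem_map_of_mem (f := clauseVars) hc
  have hcne := hne c hc
  have key : ∀ d ∈ S, clauseVars d = clauseVars c → d = c := fun d hd h => huniq hd hc h
  have h1 : decide (∃ d ∈ S, (d.1 = (c.1.1, true) ∧ d.2.1 = c.2.1) ∨
      (d.2 = (c.1.1, true) ∧ d.1.1 = c.2.1)) = c.1.2 := by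
    rw [Bool.eq_iff_iff, decide_eq_true_iff]
    constructor
    · rintro ⟨d, hd, ⟨h, h'⟩ | ⟨h, h'⟩⟩
      · rw [← key d hd (by simp [clauseVars, h, h']), h]
      · have := key d hd (by simp [clauseVars, h, h'])
        subst this
        exact absurd h' hcne
    · intro h
      exact ⟨c, hc, Or.inl ⟨Prod.ext rfl h, rfl⟩⟩
  have h2 : decide (∃ d ∈ S, (d.1 = (c.2.1, true) ∧ d.2.1 = c.1.1) ∨
      (d.2 = (c.2.1, true) ∧ d.1.1 = c.1.1)) = c.2.2 := by
    rw [Bool.eq_iff_iff, decide_eq_true_iff]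
    constructor
    · rintro ⟨d, hd, ⟨h, h'⟩ | ⟨h, h'⟩⟩
      · have := key d hd (by simp [clauseVars, h, h'])
        subst this
        exact absurd h'.symm hcne
      · rw [← key d hd (by simp [clauseVars, h, h']), h]
    · intro h
      exact ⟨c, hc, Or.inr ⟨Prod.ext rfl h, rfl⟩⟩
  have := hτ _ _ hadj
  rw [h1, h2] at this
  exact or_iff_not_imp_left.2 this

theorem HasUnsatSigning.inU {V : Type} [Finite V] {G : SimpleGraph V}
    (h : HasUnsatSigning G) : InU G := by
  classical
  have := Fintype.ofFinite V
  obtain ⟨g, hg⟩ := h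
  let clause : Sym2 V → Lit V × Lit V := fun e =>
    ((e.out.1, g e.out.1 e.out.2), (e.out.2, g e.out.2 e.out.1))
  have hclause : ∀ e, clauseVars (clause e) = e := fun e => Quot.out_eq e
  let S : TwoCNF V := G.edgeFinset.toList.map clause
  have hmap : S.map clauseVars = G.edgeFinset.toList := by
    simp only [S, List.map_map]
    exact List.map_id'' hclause _
  have hnd : (S.map clauseVars).Nodup := hmap ▸ Finset.nodup_toList _
  refine ⟨S, ⟨fun c hc => ?_, hnd⟩, ⟨hnd, ?_⟩, ?_⟩
  · have : clauseVars c ∈ S.map clauseVars := List.mem_map_of_mem hc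
    rw [hmap, Finset.mem_toList, mem_edgeFinset] at this
    exact G.ne_of_adj this
  · ext e
    rw [hmap]
    simp
  · rintro ⟨τ, hτ⟩
    obtain ⟨u, v, huv, hu, hv⟩ := hg τ
    have hsat := hτ (clause s(u, v)) (List.mem_map_of_mem (by simpa using huv))
    have hout : s((s(u, v) : Sym2 V).out.1, (s(u, v) : Sym2 V).out.2) = s(u, v) := hclause _
    simp only [clause] at hsat
    rcases Sym2.eq_iff.1 hout with ⟨h1, h2⟩ | ⟨h1, h2⟩ <;> rw [h1, h2] at hsat <;> tauto

theorem HasUnsatSigning.of_isSubgraphOf {V W : Type} {G : SimpleGraph V} {H : SimpleGraph W}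
    (hGH : IsSubgraphOf G H) (h : HasUnsatSigning G) : HasUnsatSigning H := by
  classical
  obtain ⟨f, hf, hadj⟩ := hGH
  obtain ⟨g, hg⟩ := h
  refine ⟨fun a b => decide (∃ u v, f u = a ∧ f v = b ∧ g u v = true), fun τ => ?_⟩
  obtain ⟨u, v, huv, hu, hv⟩ := hg (τ ∘ f)
  exact ⟨f u, f v, hadj huv, by simpa [hf.eq_iff] using hu, by simpa [hf.eq_iff] using hv⟩

theorem HasUnsatSigning.subdivideEdge {V : Type} {G : SimpleGraph V} {u v : V}
    (huv : G.Adj u v) (h : HasUnsatSigning G) : HasUnsatSigning (subdivideEdge G u v) := by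
  classical
  obtain ⟨g, hg⟩ := h
  have hne := huv.ne
  refine ⟨fun a b => match a, b with
    | some x, some y => g x y
    | some x, none => if x = u then g u v else g v u
    | none, some x => decide (x = u)
    | none, none => true, fun τ => ?_⟩
  obtain ⟨x, y, hxy, hx, hy⟩ := hg (fun x => τ (some x))
  by_cases he : s(x, y) = s(u, v)
  · have huv' : τ (some u) ≠ g u v ∧ τ (some v) ≠ g v u := by
      rcases Sym2.eq_iff.1 he with ⟨rfl, rfl⟩ | ⟨rfl, rfl⟩
      exacts [⟨hx, hy⟩, ⟨hy, hx⟩]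
    cases hw : τ none
    · exact ⟨some u, none, by simp [Sat2.subdivideEdge], by simpa using huv'.1, by simp [hw]⟩
    · exact ⟨some v, none, by simp [Sat2.subdivideEdge], by simpa [hne.symm] using huv'.2,
        by simp [hw, hne.symm]⟩
  · exact ⟨some x, some y, fromRel_adj _ _ _ |>.2
      ⟨by simpa using hxy.ne, Or.inl ⟨hxy, he⟩⟩, hx, hy⟩

theorem IsSubdivision.hasUnsatSigning {V W : Type} {G : SimpleGraph V} {H : SimpleGraph W}
    (hGH : IsSubdivision G H) (h : HasUnsatSigning G) : HasUnsatSigning H := by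
  induction hGH with
  | of_iso e => exact h.of_isSubgraphOf ⟨e, e.injective, fun _ _ => e.map_adj_iff.2⟩
  | step u v _ huv ih => exact (ih h).subdivideEdge huv

/-- If `G` is a topological minor of `H` and `G ∈ 𝒰`, then `H ∈ 𝒰`. -/
theorem stmt_8 {α β : Type} [Fintype α] [Fintype β]
    (G : SimpleGraph α) (H : SimpleGraph β)
    (htm : IsTopMinor G H) (hG : InU G) : InU H := by
  obtain ⟨γ, G', hsub, hemb⟩ := htm
  exact ((hsub.hasUnsatSigning hG.hasUnsatSigning).of_isSubgraphOf hemb).inU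

end Sat2
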